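/- For every k ≥ 1 and u ∈ ℂ, one has e_k(u+k−1) = trace(A_k * T_1(u) * T_2(u+1) * ⋯ * T_k(u+k−1)), i.e. the antisymmetrized product with increasing shifts of the spectral parameter computes the elementary symmetric function at the shifted argument u+k−1. -/

import Mathlib

/-- Matrices in the `k`-leg model over `A`: square matrices indexed by functions
`Fin k → Fin n`, a model of `End((ℂ^n)^⊗k) ⊗ A`. -/
abbrev LegMatrix (n k : ℕ) (A : Type*) := Matrix (Fin k → Fin n) (Fin k → Fin n) A

variable {n : ℕ} {A : Type*} [Ring A] [Algebra ℂ A]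

/-- `T_s(v)`: the generating matrix `T(v)` placed on leg `s` of the `k`-leg model. -/
def Tleg (T : ℂ → Matrix (Fin n) (Fin n) A) {k : ℕ} (s : Fin k) (v : ℂ) :
    LegMatrix n k A := fun f g =>
  if ∀ t : Fin k, t ≠ s → f t = g t then T v (f s) (g s) else 0

/-- The permutation matrix `P_σ` of a permutation `σ` of the legs:
its `(f,g)`-entry is `1` (via `algebraMap ℂ A`) if `f = g ∘ σ` and `0` otherwise. -/
def Pleg (n : ℕ) (A : Type*) [Ring A] [Algebra ℂ A] {k : ℕ} (σ : Equiv.Perm (Fin k)) :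
    LegMatrix n k A := fun f g => if f = g ∘ σ then algebraMap ℂ A 1 else 0

/-- The transposition of legs with 1-based labels `i`, `j` (identity if out of range;
all uses are in range). -/
def legSwap (k i j : ℕ) : Equiv.Perm (Fin k) :=
  if h : 1 ≤ i ∧ i ≤ k ∧ 1 ≤ j ∧ j ≤ k then
    Equiv.swap ⟨i - 1, by omega⟩ ⟨j - 1, by omega⟩ else 1

/-- The antisymmetrizer `A_k = (1/k!) • Σ_σ sgn(σ) • P_σ` in the `k`-leg model. -/
noncomputable def Aleg (n : ℕ) (A : Type*) [Ring A] [Algebra ℂ A] (k : ℕ) :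
    LegMatrix n k A :=
  ((k.factorial : ℂ))⁻¹ •
    ∑ σ : Equiv.Perm (Fin k), ((Equiv.Perm.sign σ : ℤ) : ℂ) • Pleg n A σ

/-- The symmetrizer `S_k = (1/k!) • Σ_σ P_σ` in the `k`-leg model. -/
noncomputable def Sleg (n : ℕ) (A : Type*) [Ring A] [Algebra ℂ A] (k : ℕ) :
    LegMatrix n k A :=
  ((k.factorial : ℂ))⁻¹ • ∑ σ : Equiv.Perm (Fin k), Pleg n A σ

/-- The ordered product `T_1(u) * T_2(u+d) * ⋯ * T_k(u+(k−1)d)` in the `k`-leg model. -/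
noncomputable def TT (T : ℂ → Matrix (Fin n) (Fin n) A) (k : ℕ) (u d : ℂ) :
    LegMatrix n k A :=
  ((List.finRange k).map (fun s => Tleg T s (u + d * ((s : ℕ) : ℂ)))).prod

/-- The RTT relation of the Yangian of `gl_n`:
`((u−v) • 1 − P_{1,2}) T_1(u) T_2(v) = T_2(v) T_1(u) ((u−v) • 1 − P_{1,2})`
in the 2-leg model. -/
def RTT (T : ℂ → Matrix (Fin n) (Fin n) A) : Prop :=
  ∀ u v : ℂ,
    ((u - v) • (1 : LegMatrix n 2 A) - Pleg n A (legSwap 2 1 2)) *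
        Tleg T (0 : Fin 2) u * Tleg T (1 : Fin 2) v =
      Tleg T (1 : Fin 2) v * Tleg T (0 : Fin 2) u *
        ((u - v) • (1 : LegMatrix n 2 A) - Pleg n A (legSwap 2 1 2))

/-- The elementary symmetric function
`e_k(u) = trace(A_k * T_1(u) * T_2(u−1) * ⋯ * T_k(u−k+1))`; for `k = 0` this is `1`. -/
noncomputable def esym (T : ℂ → Matrix (Fin n) (Fin n) A) (k : ℕ) (u : ℂ) : A :=
  Matrix.trace (Aleg n A k * TT T k u (-1))

/-- The homogeneous symmetric function
`h_k(u) = trace(S_k * T_1(u) * T_2(u+1) * ⋯ * T_k(u+k−1))`; for `k = 0` this is `1`. -/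
noncomputable def hsym (T : ℂ → Matrix (Fin n) (Fin n) A) (k : ℕ) (u : ℂ) : A :=
  Matrix.trace (Sleg n A k * TT T k u 1)

/-- The power sum `p⁻_k(u) = trace(T(u) * T(u−1) * ⋯ * T(u−k+1))`,
an ordinary product of `n×n` matrices over `A`. -/
noncomputable def pminus (T : ℂ → Matrix (Fin n) (Fin n) A) (k : ℕ) (u : ℂ) : A :=
  Matrix.trace (((List.finRange k).map (fun i => T (u - ((i : ℕ) : ℂ)))).prod)

/-- The power sum `p⁺_k(u) = trace(T(u) * T(u+1) * ⋯ * T(u+k−1))`,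
an ordinary product of `n×n` matrices over `A`. -/
noncomputable def pplus (T : ℂ → Matrix (Fin n) (Fin n) A) (k : ℕ) (u : ℂ) : A :=
  Matrix.trace (((List.finRange k).map (fun i => T (u + ((i : ℕ) : ℂ)))).prod)

section LegLemmas

set_option linter.unusedSectionVars false

variable {k : ℕ} {T : ℂ → Matrix (Fin n) (Fin n) A}

lemma Pleg_mul_apply (σ : Equiv.Perm (Fin k)) (M : LegMatrix n k A) (f g : Fin k → Fin n) :
    (Pleg n A σ * M) f g = M (f ∘ σ.symm) g := by
  have h : ∀ x : Fin k → Fin n, f = x ∘ σ ↔ f ∘ σ.symm = x := fun x => by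
    rw [Equiv.comp_symm_eq]
  simp [Matrix.mul_apply, Pleg, h]

lemma mul_Pleg_apply (σ : Equiv.Perm (Fin k)) (M : LegMatrix n k A) (f g : Fin k → Fin n) :
    (M * Pleg n A σ) f g = M f (g ∘ σ) := by
  simp [Matrix.mul_apply, Pleg]

lemma Pleg_mul_Pleg (σ τ : Equiv.Perm (Fin k)) :
    Pleg n A σ * Pleg n A τ = Pleg n A (τ * σ) := by
  ext f g
  rw [mul_Pleg_apply]
  simp [Pleg, Function.comp_assoc]

/-- Traces are cyclic for permutation matrices, whose entries are central. -/
lemma trace_mul_Pleg (σ : Equiv.Perm (Fin k)) (M : LegMatrix n k A) :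
    (M * Pleg n A σ).trace = (Pleg n A σ * M).trace := by
  simp only [Matrix.trace, Matrix.diag_apply, Pleg_mul_apply, mul_Pleg_apply]
  refine Fintype.sum_equiv (Equiv.arrowCongr σ.symm (Equiv.refl _)) _ _ fun f => ?_
  congr 1
  ext t
  simp [Equiv.arrowCongr]

lemma Tleg_mul_Pleg (σ : Equiv.Perm (Fin k)) (s : Fin k) (v : ℂ) :
    Tleg T s v * Pleg n A σ = Pleg n A σ * Tleg T (σ s) v := by
  ext f g
  have h : (∀ t, t ≠ s → f t = (g ∘ σ) t) ↔ ∀ t, t ≠ σ s → (f ∘ σ.symm) t = g t := by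
    refine ⟨fun H t ht => ?_, fun H t ht => ?_⟩
    · simpa using H (σ.symm t) (by rwa [Ne, Equiv.symm_apply_eq])
    · simpa using H (σ t) (by simpa using ht)
  rw [mul_Pleg_apply, Pleg_mul_apply]
  simp only [Tleg, h]
  simp

lemma sign_smul_sign_smul {M : Type*} [AddCommGroup M] [Module ℂ M]
    (σ : Equiv.Perm (Fin k)) (x : M) :
    ((Equiv.Perm.sign σ : ℤ) : ℂ) • ((Equiv.Perm.sign σ : ℤ) : ℂ) • x = x := by
  rcases Int.units_eq_one_or (Equiv.Perm.sign σ) with h | h <;> simp [h]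

lemma Aleg_mul_Pleg (τ : Equiv.Perm (Fin k)) :
    Aleg n A k * Pleg n A τ = ((Equiv.Perm.sign τ : ℤ) : ℂ) • Aleg n A k := by
  rw [Aleg, smul_mul_assoc, smul_comm]
  congr 1
  rw [Finset.sum_mul, Finset.smul_sum]
  refine Fintype.sum_equiv (Equiv.mulLeft τ) _ _ fun σ => ?_
  simp only [Equiv.coe_mulLeft, Equiv.Perm.sign_mul, Units.val_mul, Int.cast_mul, mul_smul,
    sign_smul_sign_smul, smul_mul_assoc, Pleg_mul_Pleg]

lemma Pleg_mul_Aleg (τ : Equiv.Perm (Fin k)) :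
    Pleg n A τ * Aleg n A k = ((Equiv.Perm.sign τ : ℤ) : ℂ) • Aleg n A k := by
  rw [Aleg, mul_smul_comm, smul_comm]
  congr 1
  rw [Finset.mul_sum, Finset.smul_sum]
  refine Fintype.sum_equiv (Equiv.mulRight τ) _ _ fun σ => ?_
  rw [Equiv.coe_mulRight, Equiv.Perm.sign_mul, mul_comm (Equiv.Perm.sign σ)]
  simp only [Units.val_mul, Int.cast_mul, mul_smul,
    sign_smul_sign_smul, mul_smul_comm, Pleg_mul_Pleg]

lemma trace_Aleg_mul_Pleg_mul (σ : Equiv.Perm (Fin k)) (X : LegMatrix n k A) :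
    (Aleg n A k * (Pleg n A σ * X)).trace =
      ((Equiv.Perm.sign σ : ℤ) : ℂ) • (Aleg n A k * X).trace := by
  rw [← mul_assoc, Aleg_mul_Pleg, smul_mul_assoc, Matrix.trace_smul]

lemma trace_Aleg_mul_mul_Pleg (σ : Equiv.Perm (Fin k)) (X : LegMatrix n k A) :
    (Aleg n A k * (X * Pleg n A σ)).trace =
      ((Equiv.Perm.sign σ : ℤ) : ℂ) • (Aleg n A k * X).trace := by
  rw [← mul_assoc, trace_mul_Pleg, ← mul_assoc, Pleg_mul_Aleg, smul_mul_assoc,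
    Matrix.trace_smul]

lemma Tleg_mul_Tleg_apply {i j : Fin k} (hij : i ≠ j) (a b : ℂ) (f g : Fin k → Fin n) :
    (Tleg T i a * Tleg T j b) f g =
      if ∀ t, t ≠ i → t ≠ j → f t = g t then T a (f i) (g i) * T b (f j) (g j) else 0 := by
  rw [Matrix.mul_apply, Finset.sum_eq_single (Function.update f i (g i))]
  · have h1 : ∀ t, t ≠ i → f t = Function.update f i (g i) t := fun t ht => by simp [ht]
    have h2 : (∀ t, t ≠ j → Function.update f i (g i) t = g t) ↔
        ∀ t, t ≠ i → t ≠ j → f t = g t := by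
      refine forall_congr' fun t => ?_
      by_cases ht : t = i
      · subst ht; simp
      · simp [ht]
    simp only [Tleg, if_pos h1, h2, Function.update_self, Function.update_of_ne hij.symm,
      mul_ite, mul_zero]
  · intro h _ hh
    by_cases h1 : ∀ t, t ≠ i → f t = h t
    · have h2 : ¬ ∀ t, t ≠ j → h t = g t := fun h2 => hh <| by
        ext t
        by_cases ht : t = i
        · subst ht; simp [h2 _ hij]
        · simp [ht, h1 t ht]
      simp only [Tleg, if_neg h2, mul_zero]
    · simp only [Tleg, if_neg h1, zero_mul]
  · simp

/-- The RTT relation in terms of matrix entries. -/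
lemma RTT.apply (hT : RTT T) (a b : ℂ) (p q r s : Fin n) :
    (a - b) • (T a p q * T b r s) - T a r q * T b p s =
      (a - b) • (T b r s * T a p q) - T b r q * T a p s := by
  have hab := hT a b
  rw [mul_assoc] at hab
  have h := congrFun (congrFun hab ![p, r]) ![q, s]
  have hs : legSwap 2 1 2 = Equiv.swap 0 1 := rfl
  simpa [hs, sub_mul, mul_sub, Pleg_mul_apply, mul_Pleg_apply,
    Tleg_mul_Tleg_apply, Fin.forall_fin_two] using h

/-- The RTT relation on two distinct legs `i`, `j` of the `k`-leg model. -/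
lemma RTT.legs (hT : RTT T) {i j : Fin k} (hij : i ≠ j) (a b : ℂ) :
    ((a - b) • (1 : LegMatrix n k A) - Pleg n A (Equiv.swap i j)) * (Tleg T i a * Tleg T j b) =
      (Tleg T j b * Tleg T i a) *
        ((a - b) • (1 : LegMatrix n k A) - Pleg n A (Equiv.swap i j)) := by
  ext f g
  have hL : (∀ t, t ≠ i → t ≠ j → (f ∘ Equiv.swap i j) t = g t) ↔
      ∀ t, t ≠ i → t ≠ j → f t = g t :=
    forall_congr' fun t => forall_congr' fun hi => forall_congr' fun hj => by
      simp [Equiv.swap_apply_of_ne_of_ne hi hj]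
  have hR : (∀ t, t ≠ j → t ≠ i → f t = (g ∘ Equiv.swap i j) t) ↔
      ∀ t, t ≠ i → t ≠ j → f t = g t :=
    forall_congr' fun t => ⟨fun h hi hj => by
      simpa [Equiv.swap_apply_of_ne_of_ne hi hj] using h hj hi, fun h hj hi => by
      simpa [Equiv.swap_apply_of_ne_of_ne hi hj] using h hi hj⟩
  have hC : (∀ t, t ≠ j → t ≠ i → f t = g t) ↔ ∀ t, t ≠ i → t ≠ j → f t = g t :=
    forall_congr' fun t => ⟨fun h hi hj => h hj hi, fun h hj hi => h hi hj⟩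
  simp only [sub_mul, mul_sub, smul_mul_assoc, mul_smul_comm, one_mul, mul_one,
    Matrix.sub_apply, Matrix.smul_apply, Pleg_mul_apply, mul_Pleg_apply,
    Tleg_mul_Tleg_apply hij, Tleg_mul_Tleg_apply hij.symm, Equiv.symm_swap, hL, hR, hC]
  split_ifs
  · simpa using hT.apply a b (f i) (g i) (f j) (g j)
  · simp

/-- The product of the `T_s(a_s)` over a list of legs. -/
def legProd (T : ℂ → Matrix (Fin n) (Fin n) A) (a : Fin k → ℂ) (l : List (Fin k)) :
    LegMatrix n k A := (l.map fun s => Tleg T s (a s)).prod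

lemma legProd_append (a : Fin k → ℂ) (l m : List (Fin k)) :
    legProd T a (l ++ m) = legProd T a l * legProd T a m := by
  simp [legProd]

lemma legProd_cons (a : Fin k → ℂ) (s : Fin k) (l : List (Fin k)) :
    legProd T a (s :: l) = Tleg T s (a s) * legProd T a l := by
  simp [legProd]

lemma legProd_mul_Pleg (a : Fin k → ℂ) (σ : Equiv.Perm (Fin k)) (l : List (Fin k)) :
    legProd T a l * Pleg n A σ =
      Pleg n A σ * legProd T (a ∘ σ.symm) (l.map σ) := by
  induction l with
  | nil => simp [legProd]
  | cons s l ih =>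
    rw [List.map_cons, legProd_cons, legProd_cons, mul_assoc, ih, ← mul_assoc, Tleg_mul_Pleg,
      mul_assoc]
    simp

lemma commute_legProd_Pleg_swap (a : Fin k → ℂ) {i j : Fin k} {l : List (Fin k)}
    (hi : i ∉ l) (hj : j ∉ l) : Commute (legProd T a l) (Pleg n A (Equiv.swap i j)) := by
  induction l with
  | nil => simp [legProd]
  | cons s l ih =>
    simp only [List.mem_cons, not_or] at hi hj
    rw [legProd_cons]
    refine Commute.mul_left ?_ (ih hi.2 hj.2)
    rw [Commute, SemiconjBy, Tleg_mul_Pleg,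
      Equiv.swap_apply_of_ne_of_ne (Ne.symm hi.1) (Ne.symm hj.1)]

lemma trace_Aleg_legProd_swap (hT : RTT T) (a : Fin k → ℂ) {i j : Fin k} (l m : List (Fin k))
    (hl : (l ++ i :: j :: m).Nodup) (ha : a i - a j + 1 ≠ 0) :
    (Aleg n A k * legProd T a (l ++ i :: j :: m)).trace =
      (Aleg n A k * legProd T a (l ++ j :: i :: m)).trace := by
  have hij : i ≠ j := by rintro rfl; simp [List.nodup_append] at hl
  have hil : i ∉ l ∧ j ∉ l ∧ i ∉ m ∧ j ∉ m := by
    simp only [List.nodup_append, List.nodup_cons, List.mem_cons] at hl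
    grind
  obtain ⟨hil, hjl, him, hjm⟩ := hil
  set P := Pleg n A (Equiv.swap i j)
  set L := legProd T a l
  set M := legProd T a m
  have hL : L * P = P * L := commute_legProd_Pleg_swap a hil hjl
  have hM : M * P = P * M := commute_legProd_Pleg_swap a him hjm
  have hsign : ((Equiv.Perm.sign (Equiv.swap i j) : ℤ) : ℂ) = -1 := by
    simp [Equiv.Perm.sign_swap hij]
  have e1 : L * (((a i - a j) • 1 - P) * (Tleg T i (a i) * Tleg T j (a j))) * M =
      (a i - a j) • legProd T a (l ++ i :: j :: m) - P * legProd T a (l ++ i :: j :: m) := by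
    simp only [legProd_append, legProd_cons, sub_mul, mul_sub, smul_mul_assoc, mul_smul_comm,
      one_mul, ← mul_assoc, ← hL, L, M]
  have e2 : L * (Tleg T j (a j) * Tleg T i (a i) * ((a i - a j) • 1 - P)) * M =
      (a i - a j) • legProd T a (l ++ j :: i :: m) - legProd T a (l ++ j :: i :: m) * P := by
    have : ∀ X : LegMatrix n k A, X * M * P = X * P * M := fun X => by
      rw [mul_assoc, hM, mul_assoc]
    simp only [legProd_append, legProd_cons, sub_mul, mul_sub, smul_mul_assoc, mul_smul_comm,
      mul_one, ← mul_assoc, L, M, this]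
  rw [hT.legs hij] at e1
  have key := congrArg (fun X => (Aleg n A k * X).trace) (e1.symm.trans e2)
  simp only [P, mul_sub, mul_smul_comm, Matrix.trace_sub, Matrix.trace_smul,
    trace_Aleg_mul_Pleg_mul, trace_Aleg_mul_mul_Pleg, hsign, neg_smul, one_smul,
    sub_neg_eq_add] at key
  refine smul_right_injective A ha ?_
  simpa only [add_smul, one_smul] using key

lemma trace_Aleg_legProd_move (hT : RTT T) (a : Fin k → ℂ) {i : Fin k} (l m r : List (Fin k))
    (hl : (l ++ i :: (m ++ r)).Nodup) (ha : ∀ j ∈ m, a i - a j + 1 ≠ 0) :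
    (Aleg n A k * legProd T a (l ++ i :: (m ++ r))).trace =
      (Aleg n A k * legProd T a (l ++ m ++ i :: r)).trace := by
  induction m generalizing l with
  | nil => simp
  | cons j m ih =>
    have hp : (l ++ i :: j :: (m ++ r)).Perm ((l ++ [j]) ++ i :: (m ++ r)) := by
      simpa using (List.Perm.swap j i (m ++ r)).append_left l
    rw [List.cons_append] at hl ⊢
    rw [trace_Aleg_legProd_swap hT a _ _ hl (ha j (by simp))]
    simpa using ih (l ++ [j]) (hp.nodup_iff.1 hl) fun x hx => ha x (by simp [hx])

/-- Under the trace against the antisymmetrizer, the order of the factors can be reversed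
as long as no swap meets the degenerate difference `-1` of spectral parameters. -/
lemma trace_Aleg_legProd_reverse (hT : RTT T) (a : Fin k → ℂ) (m r : List (Fin k))
    (hl : (m ++ r).Nodup) (ha : m.Pairwise fun i j => a i - a j + 1 ≠ 0) :
    (Aleg n A k * legProd T a (m ++ r)).trace =
      (Aleg n A k * legProd T a (m.reverse ++ r)).trace := by
  induction m generalizing r with
  | nil => simp
  | cons i m ih =>
    rw [List.pairwise_cons] at ha
    have hmove := trace_Aleg_legProd_move hT a [] m r hl ha.1
    have hnd : (m ++ i :: r).Nodup := List.perm_middle.nodup_iff.2 hl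
    simpa using hmove.trans (ih (i :: r) hnd ha.2)

lemma trace_Aleg_legProd_map (a : Fin k → ℂ) (σ : Equiv.Perm (Fin k)) (l : List (Fin k)) :
    (Aleg n A k * legProd T (a ∘ σ.symm) (l.map σ)).trace =
      (Aleg n A k * legProd T a l).trace := by
  have h := congrArg (fun X => (Aleg n A k * X).trace) (legProd_mul_Pleg (T := T) a σ l)
  simp only [trace_Aleg_mul_Pleg_mul, trace_Aleg_mul_mul_Pleg] at h
  simpa only [sign_smul_sign_smul] using
    (congrArg (fun x => ((Equiv.Perm.sign σ : ℤ) : ℂ) • x) h).symm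

end LegLemmas

/-- `e_k(u+k−1) = trace(A_k T_1(u) T_2(u+1) ⋯ T_k(u+k−1))`. -/
theorem esym_shifted_eq (hn : 1 ≤ n) (T : ℂ → Matrix (Fin n) (Fin n) A)
    (hT : RTT T) (k : ℕ) (hk : 1 ≤ k) (u : ℂ) :
    esym T k (u + (k : ℂ) - 1) = Matrix.trace (Aleg n A k * TT T k u 1) := by
  have hrev := trace_Aleg_legProd_reverse hT
    (fun s : Fin k => u + (k : ℂ) - 1 + -1 * ((s : ℕ) : ℂ)) (List.finRange k) []
    (by simpa using List.nodup_finRange k)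
    ((List.pairwise_lt_finRange k).imp fun {i j} hij h => by
      have h' : ((j : ℕ) : ℂ) + 1 = ((i : ℕ) : ℂ) := by linear_combination h
      have h'' : (j : ℕ) + 1 = i := by exact_mod_cast h'
      omega)
  have hconj := trace_Aleg_legProd_map (T := T)
    (fun s : Fin k => u + 1 * ((s : ℕ) : ℂ)) Fin.revPerm (List.finRange k)
  have hpar : (fun s : Fin k => u + 1 * ((s : ℕ) : ℂ)) ∘ Fin.revPerm.symm =
      fun s : Fin k => u + (k : ℂ) - 1 + -1 * ((s : ℕ) : ℂ) := by
    ext s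
    simp only [Function.comp_apply, Fin.revPerm_symm, Fin.revPerm_apply, Fin.val_rev]
    rw [Nat.cast_sub (by omega)]
    push_cast
    ring
  have hlist : (List.finRange k).map Fin.revPerm = (List.finRange k).reverse := by
    rw [List.finRange_reverse]
    rfl
  rw [List.append_nil, List.append_nil] at hrev
  rw [hpar, hlist] at hconj
  exact hrev.trans hconj
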